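/- arXiv:2209.03266 — 2 statements merged into one kernel-verified Lean document; each statement's English description precedes it below -/
import Mathlib

section
/- For every integer i ≥ 0 and every code word c over the alphabet {1,2,3,4,5} belonging to the language 212{12,1112}^i, the finite Restivo word R(c) avoids 7/3-powers and contains overlaps of exactly i different periods; that is, the set of integers n ≥ 1 such that R(c) has a factor of length 2n+1 with period n has exactly i elements. -/
/-- The Thue–Morse morphism μ : 0 ↦ 01, 1 ↦ 10 (false = 0, true = 1),
extended to finite binary words. -/
def mu (w : List Bool) : List Bool := (w.map (fun b => [b, !b])).flatten

/-- The set S = {ε, 0, 1, 00, 11}. -/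
def S : Set (List Bool) := {[], [false], [true], [false, false], [true, true]}

/-- A finite word `u` is a prefix of the infinite word `w`. -/
def PrefixSeq {α : Type*} (u : List α) (w : ℕ → α) : Prop :=
  ∀ (j : ℕ) (h : j < u.length), u.get ⟨j, h⟩ = w j

/-- A finite word `u` is a factor of the infinite word `w`. -/
def IsFactorSeq (u : List Bool) (w : ℕ → Bool) : Prop :=
  ∃ i : ℕ, ∀ (j : ℕ) (h : j < u.length), u.get ⟨j, h⟩ = w (i + j)

/-- The finite word `u` has period `p` (with `1 ≤ p ≤ |u|`):
`u[i] = u[i+p]` for all `0 ≤ i < |u| - p`. -/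
def HasPeriod (u : List Bool) (p : ℕ) : Prop :=
  1 ≤ p ∧ p ≤ u.length ∧ ∀ i, i + p < u.length → u.getD i false = u.getD (i + p) false

/-- The least period of a finite word. -/
noncomputable def leastPeriod (u : List Bool) : ℕ := sInf {p | HasPeriod u p}

/-- The exponent of a nonempty finite word: its length divided by its least period. -/
noncomputable def exponent (u : List Bool) : ℚ := (u.length : ℚ) / (leastPeriod u : ℚ)

/-- A finite word avoids α-powers: no nonempty factor has exponent ≥ α. -/
def AvoidsPow (a : ℚ) (w : List Bool) : Prop :=
  ∀ u : List Bool, u ≠ [] → u <:+: w → exponent u < a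

/-- A finite word avoids α⁺-powers: no nonempty factor has exponent > α. -/
def AvoidsPowPlus (a : ℚ) (w : List Bool) : Prop :=
  ∀ u : List Bool, u ≠ [] → u <:+: w → exponent u ≤ a

/-- An infinite word avoids α-powers. -/
def AvoidsPowSeq (a : ℚ) (w : ℕ → Bool) : Prop :=
  ∀ u : List Bool, u ≠ [] → IsFactorSeq u w → exponent u < a

/-- An infinite word avoids α⁺-powers. -/
def AvoidsPowPlusSeq (a : ℚ) (w : ℕ → Bool) : Prop :=
  ∀ u : List Bool, u ≠ [] → IsFactorSeq u w → exponent u ≤ a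

/-- An overlap is a word of the form a x a x a, with a a single letter. -/
def IsOverlap (u : List Bool) : Prop :=
  ∃ (a : Bool) (x : List Bool), u = [a] ++ x ++ [a] ++ x ++ [a]

/-- Overlap-freeness for finite words. -/
def OverlapFree (w : List Bool) : Prop := ∀ u : List Bool, u <:+: w → ¬ IsOverlap u

/-- Overlap-freeness for infinite words. -/
def OverlapFreeSeq (w : ℕ → Bool) : Prop := ∀ u : List Bool, IsFactorSeq u w → ¬ IsOverlap u

/-- The Thue–Morse word t = 0110100110010110⋯ : t[n] = 1 iff the number of
ones in the binary expansion of n is odd. -/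
def thueMorse : ℕ → Bool := fun n => (Nat.digits 2 n).count 1 % 2 == 1

/-- The complement t̄ of the Thue–Morse word. -/
def tmbar : ℕ → Bool := fun n => ! thueMorse n

/-- The infinite word obtained by prepending the finite word `u` to `w`. -/
def appendSeq (u : List Bool) (w : ℕ → Bool) : ℕ → Bool :=
  fun n => if h : n < u.length then u.get ⟨n, h⟩ else w (n - u.length)

/-- Lexicographic order on infinite binary words (with 0 < 1). -/
def seqLE (v w : ℕ → Bool) : Prop :=
  v = w ∨ ∃ n : ℕ, (∀ i < n, v i = w i) ∧ v n = false ∧ w n = true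

/-- The word x₀ μ(x₁) μ²(x₂) ⋯ μ^{n-1}(x_{n-1}). -/
def restivoJoin (x : ℕ → List Bool) (n : ℕ) : List Bool :=
  ((List.range n).map (fun i => mu^[i] (x i))).flatten

/-- Finite Restivo words: x₀ μ(x₁) ⋯ μ^t(x_t) with all xᵢ ∈ S. -/
def IsRestivo (w : List Bool) : Prop :=
  ∃ (t : ℕ) (x : ℕ → List Bool), (∀ i ≤ t, x i ∈ S) ∧ w = restivoJoin x (t + 1)

/-- Infinite Restivo words: x₀ μ(x₁) μ²(x₂) ⋯ with all xᵢ ∈ S and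
infinitely many xᵢ nonempty. -/
def IsRestivoSeq (w : ℕ → Bool) : Prop :=
  ∃ x : ℕ → List Bool, (∀ i, x i ∈ S) ∧ (∀ N : ℕ, ∃ i ≥ N, x i ≠ []) ∧
    ∀ n : ℕ, PrefixSeq (restivoJoin x n) w

/-- The coding g : 1 ↦ ε, 2 ↦ 0, 3 ↦ 1, 4 ↦ 00, 5 ↦ 11. -/
def g : ℕ → List Bool
  | 1 => []
  | 2 => [false]
  | 3 => [true]
  | 4 => [false, false]
  | 5 => [true, true]
  | _ => []

/-- The finite Restivo word R(c₀c₁⋯c_t) = g(c₀) μ(g(c₁)) ⋯ μ^t(g(c_t)). -/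
def R (c : List ℕ) : List Bool :=
  ((List.range c.length).map (fun i => mu^[i] (g (c.getD i 0)))).flatten

lemma mu_cons (b : Bool) (w : List Bool) : mu (b :: w) = b :: (!b) :: mu w := rfl

lemma length_mu (w : List Bool) : (mu w).length = 2 * w.length := by
  induction w with
  | nil => rfl
  | cons b w ih => simp only [mu_cons, List.length_cons, ih]; ring

lemma mu_getD_even (w : List Bool) (t : ℕ) :
    (mu w).getD (2 * t) false = w.getD t false := by
  induction w generalizing t with
  | nil => rfl
  | cons b w ih =>
    cases t with
    | zero => rfl
    | succ t => simpa only [mu_cons, Nat.mul_succ, List.getD_cons_succ] using ih t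

lemma mu_getD_odd (w : List Bool) (t : ℕ) (ht : t < w.length) :
    (mu w).getD (2 * t + 1) false = !w.getD t false := by
  induction w generalizing t with
  | nil => simp at ht
  | cons b w ih =>
    cases t with
    | zero => rfl
    | succ t =>
      simpa only [mu_cons, Nat.mul_succ, List.getD_cons_succ] using ih t (by simpa using ht)

/-- Positions `j ∈ [s, e)` of `w` all carry the same letter as position `j + n` of `w`;
that is, the factor of `w` at positions `[s, e + n)` has period `n`. -/
def Repeats (w : List Bool) (n s e : ℕ) : Prop :=
  e + n ≤ w.length ∧ ∀ j, s ≤ j → j < e → w.getD j false = w.getD (j + n) false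

lemma Repeats.mono {w : List Bool} {n s e s' e' : ℕ} (h : Repeats w n s e)
    (hs : s ≤ s') (he : e' ≤ e) : Repeats w n s' e' :=
  ⟨by have := h.1; omega, fun j h1 h2 => h.2 j (by omega) (by omega)⟩

lemma repeats_cons_iff {a : Bool} {w : List Bool} {n s e : ℕ} :
    Repeats (a :: w) n (s + 1) (e + 1) ↔ Repeats w n s e := by
  constructor
  · intro h
    refine ⟨by have := h.1; simp at this; omega, fun j h1 h2 => ?_⟩
    have := h.2 (j + 1) (by omega) (by omega)
    rwa [show j + 1 + n = j + n + 1 by omega, List.getD_cons_succ, List.getD_cons_succ] at this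
  · intro h
    refine ⟨by have := h.1; simp; omega, fun j h1 h2 => ?_⟩
    obtain ⟨j, rfl⟩ : ∃ k, j = k + 1 := ⟨j - 1, by omega⟩
    rw [show j + 1 + n = j + n + 1 by omega, List.getD_cons_succ, List.getD_cons_succ]
    exact h.2 j (by omega) (by omega)

lemma Repeats.mu_double {w : List Bool} {n s e : ℕ} (h : Repeats w n s e) :
    Repeats (mu w) (2 * n) (2 * s) (2 * e) := by
  have hl := h.1
  refine ⟨by rw [length_mu]; omega, fun j h1 h2 => ?_⟩
  have := h.2 (j / 2) (by omega) (by omega)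
  rcases Nat.even_or_odd' j with ⟨t, rfl | rfl⟩
  · rw [← Nat.mul_add, mu_getD_even, mu_getD_even]
    simpa using this
  · rw [show 2 * t + 1 + 2 * n = 2 * (t + n) + 1 by ring, mu_getD_odd _ _ (by omega),
      mu_getD_odd _ _ (by omega)]
    rw [show (2 * t + 1) / 2 = t by omega] at this
    rw [this]

lemma Repeats.of_mu {w : List Bool} {n s e : ℕ} (h : Repeats (mu w) (2 * n) s e)
    (hse : s = 0 ∨ s < e) : Repeats w n (s / 2) ((e + 1) / 2) := by
  have hl := h.1
  rw [length_mu] at hl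
  refine ⟨by omega, fun t h1 h2 => ?_⟩
  by_cases hs : s ≤ 2 * t
  · have := h.2 (2 * t) hs (by omega)
    rwa [← Nat.mul_add, mu_getD_even, mu_getD_even] at this
  · have := h.2 (2 * t + 1) (by omega) (by omega)
    rw [show 2 * t + 1 + 2 * n = 2 * (t + n) + 1 by ring, mu_getD_odd _ _ (by omega),
      mu_getD_odd _ _ (by omega)] at this
    simpa using this

/-- If `w` is cut into two-letter blocks `01`, `10` at the positions of parity `r`, a repetition
of odd period forces the letters it covers to alternate. -/
lemma Repeats.alternating {w : List Bool} {n s e r : ℕ} (h : Repeats w n s e) (hn : n % 2 = 1)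
    (hw : ∀ j, j % 2 = r % 2 → j + 1 < w.length → w.getD (j + 1) false = !w.getD j false)
    (k : ℕ) (hk : s + k < e) : w.getD (s + k) false = (w.getD s false ^^ decide (k % 2 = 1)) := by
  have hl := h.1
  induction k with
  | zero => simp
  | succ k ih =>
    have ih := ih (by omega)
    have hstep : w.getD (s + k + 1) false = !w.getD (s + k) false := by
      by_cases hp : (s + k) % 2 = r % 2
      · exact hw _ hp (by omega)
      · have := hw (s + k + n) (by omega) (by omega)
        rw [h.2 (s + k) (by omega) (by omega), h.2 (s + k + 1) (by omega) (by omega),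
          show s + k + 1 + n = s + k + n + 1 by omega, this]
    rw [← Nat.add_assoc, hstep, ih]
    rcases Nat.mod_two_eq_zero_or_one k with hk2 | hk2
    · have : (k + 1) % 2 = 1 := by omega
      simp [hk2, this]
    · have : (k + 1) % 2 = 0 := by omega
      simp [hk2, this]

lemma mu_blocks (w : List Bool) (j : ℕ) (hj : j % 2 = 0 % 2) (hl : j + 1 < (mu w).length) :
    (mu w).getD (j + 1) false = !(mu w).getD j false := by
  rw [length_mu] at hl
  obtain ⟨t, rfl⟩ : ∃ t, j = 2 * t := ⟨j / 2, by omega⟩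
  rw [mu_getD_even, mu_getD_odd _ _ (by omega)]

lemma cons_mu_blocks (a : Bool) (w : List Bool) (j : ℕ) (hj : j % 2 = 1 % 2)
    (hl : j + 1 < (a :: mu w).length) :
    (a :: mu w).getD (j + 1) false = !(a :: mu w).getD j false := by
  obtain ⟨t, rfl⟩ : ∃ t, j = t + 1 := ⟨j - 1, by omega⟩
  rw [List.getD_cons_succ, List.getD_cons_succ]
  exact mu_blocks w t (by omega) (by simpa using hl)

/-- A word cut into two-letter blocks `01`, `10` has no overlap of odd period. -/
lemma Repeats.even_of_overlap {w : List Bool} {n s e r : ℕ} (h : Repeats w n s e)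
    (hw : ∀ j, j % 2 = r % 2 → j + 1 < w.length → w.getD (j + 1) false = !w.getD j false)
    (he : s + n < e) : n % 2 = 0 := by
  by_contra hn
  have hn : n % 2 = 1 := by omega
  have h1 := h.alternating hn hw n he
  rw [← h.2 s le_rfl (by omega)] at h1
  simp [hn] at h1

/-- A square which is a prefix of `mu w` has even period. -/
lemma Repeats.even_of_initial_square {w : List Bool} {n e : ℕ} (h : Repeats (mu w) n 0 e)
    (he : n ≤ e) : n % 2 = 0 := by
  by_contra hn
  have hn : n % 2 = 1 := by omega
  have hl := h.1
  have h1 := h.alternating hn (mu_blocks w) (n - 1) (by omega)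
  have h2 := mu_blocks w (n - 1) (by omega) (by omega)
  have h3 := h.2 0 le_rfl (by omega)
  rw [show n - 1 + 1 = 0 + n by omega, ← h3] at h2
  have h4 : ¬ (n - 1) % 2 = 1 := by omega
  rw [Nat.zero_add] at h1
  rw [h1] at h2
  simp [h4] at h2

/-- An overlap, or a square prefix, of `mu^[k] w` comes from one of `w`. -/
lemma Repeats.of_iterate_mu (k : ℕ) {w : List Bool} {n s e : ℕ}
    (h : Repeats (mu^[k] w) n s e) (he : s + n < e ∨ (s = 0 ∧ n ≤ e)) :
    ∃ q s' e', n = 2 ^ k * q ∧ e - s ≤ 2 ^ k * (e' - s') ∧ Repeats w q s' e' ∧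
      (s' + q < e' ∨ (s = 0 ∧ q ≤ e')) ∧ (s + n < e → s' + q < e') ∧ (s = 0 → s' = 0) := by
  induction k generalizing n s e with
  | zero =>
    exact ⟨n, s, e, by simp, by simp, h, he, id, id⟩
  | succ k ih =>
    rw [Function.iterate_succ_apply'] at h
    have hn : n % 2 = 0 := by
      rcases he with he | ⟨rfl, he⟩
      · exact h.even_of_overlap (mu_blocks _) he
      · exact h.even_of_initial_square he
    obtain ⟨m, rfl⟩ : ∃ m, n = 2 * m := ⟨n / 2, by omega⟩
    obtain ⟨q, s', e', hq, hD, hr, h1, h2, h3⟩ := ih (h.of_mu (by omega)) (by omega)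
    refine ⟨q, s', e', by rw [hq]; ring, ?_, hr, ?_, fun hh => h2 (by omega),
      fun hh => h3 (by omega)⟩
    · rw [show 2 ^ (k + 1) * (e' - s') = 2 * (2 ^ k * (e' - s')) by ring]
      omega
    · rcases h1 with h1 | ⟨h1, h4⟩
      · exact Or.inl h1
      · by_cases hs : s = 0
        · exact Or.inr ⟨hs, h4⟩
        · exact Or.inl (h2 (by omega))

lemma Repeats.iterate_mu (k : ℕ) {w : List Bool} {n s e : ℕ} (h : Repeats w n s e) :
    Repeats (mu^[k] w) (2 ^ k * n) (2 ^ k * s) (2 ^ k * e) := by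
  induction k with
  | zero => simpa using h
  | succ k ih =>
    rw [Function.iterate_succ_apply']
    have := ih.mu_double
    simpa only [pow_succ', Nat.mul_assoc] using this

lemma length_iterate_mu (k : ℕ) (w : List Bool) : (mu^[k] w).length = 2 ^ k * w.length := by
  induction k with
  | zero => simp
  | succ k ih => rw [Function.iterate_succ_apply', length_mu, ih]; ring

/-- The last letter of each block of an even iterate of `mu` is the letter it comes from. -/
lemma iterate_mu_getD_last (m : ℕ) (w : List Bool) (q : ℕ) (hq : 1 ≤ q) (hl : q ≤ w.length) :
    (mu^[2 * m] w).getD (2 ^ (2 * m) * q - 1) false = w.getD (q - 1) false := by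
  induction m with
  | zero => simp
  | succ m ih =>
    have hlen := length_iterate_mu (2 * m) w
    have hle : 2 ^ (2 * m) * q ≤ (mu^[2 * m] w).length := by
      rw [hlen]; exact Nat.mul_le_mul_left _ hl
    have hpos : 0 < 2 ^ (2 * m) * q := by positivity
    rw [Nat.mul_succ, Function.iterate_succ_apply', Function.iterate_succ_apply']
    have h4 : 2 ^ (2 * m + 2) * q = 4 * (2 ^ (2 * m) * q) := by ring
    rw [h4, ← ih]
    generalize 2 ^ (2 * m) * q = N at *
    rw [show 4 * N - 1 = 2 * (2 * (N - 1) + 1) + 1 by omega,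
      mu_getD_odd _ _ (by rw [length_mu]; omega), mu_getD_odd _ _ (by omega), Bool.not_not]

lemma iterate_mu_getD_zero (k : ℕ) (w : List Bool) :
    (mu^[k] w).getD 0 false = w.getD 0 false := by
  induction k with
  | zero => rfl
  | succ k ih =>
    rw [Function.iterate_succ_apply', ← ih]
    exact mu_getD_even _ 0

/-- The periods of the overlaps in `w`. -/
def overlapPeriods (w : List Bool) : Set ℕ := {n | 1 ≤ n ∧ ∃ s, Repeats w n s (s + n + 1)}

/-- The periods of the squares `xx` which are prefixes of `w`, with `x` ending in `0`. -/
def zeroSquarePeriods (w : List Bool) : Set ℕ :=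
  {n | 1 ≤ n ∧ Repeats w n 0 n ∧ w.getD (n - 1) false = false}

lemma overlapPeriods_cons_iterate_mu (m : ℕ) (w : List Bool) :
    overlapPeriods (false :: mu^[2 * m] w) =
      (fun q => 2 ^ (2 * m) * q) '' (overlapPeriods w ∪ zeroSquarePeriods w) := by
  ext n
  constructor
  · rintro ⟨hn, s, h⟩
    rcases s with _ | s
    · have h' : Repeats (mu^[2 * m] w) n 0 n :=
        repeats_cons_iff.1 (h.mono (Nat.zero_le _) (by omega))
      obtain ⟨q, s', e', rfl, -, hr, h1, -, h3⟩ := h'.of_iterate_mu _ (Or.inr ⟨rfl, le_rfl⟩)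
      obtain rfl := h3 rfl
      have hq : 1 ≤ q := Nat.pos_of_mul_pos_left hn
      have hqe : q ≤ e' := by omega
      refine ⟨q, Or.inr ⟨hq, hr.mono le_rfl hqe, ?_⟩, rfl⟩
      have hr1 := hr.1
      rw [← iterate_mu_getD_last m w q hq (by omega)]
      have h0 := h.2 0 le_rfl (by omega)
      rw [show 0 + 2 ^ (2 * m) * q = 2 ^ (2 * m) * q - 1 + 1 by omega, List.getD_cons_succ] at h0
      exact h0.symm
    · have h' : Repeats (mu^[2 * m] w) n s (s + n + 1) :=
        repeats_cons_iff.1 (h.mono le_rfl (by omega))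
      obtain ⟨q, s', e', rfl, -, hr, -, h2, -⟩ := h'.of_iterate_mu _ (Or.inl (by omega))
      have hq : 1 ≤ q := Nat.pos_of_mul_pos_left hn
      exact ⟨q, Or.inl ⟨hq, s', hr.mono le_rfl (by have := h2 (by omega); omega)⟩, rfl⟩
  · have hpow : 1 ≤ 2 ^ (2 * m) := Nat.one_le_two_pow
    rintro ⟨q, ⟨hq, s, h⟩ | ⟨hq, h, hlast⟩, rfl⟩
    · refine ⟨Nat.mul_pos hpow hq, 2 ^ (2 * m) * s + 1, ?_⟩
      have := repeats_cons_iff (a := false).2 (h.iterate_mu (2 * m))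
      refine this.mono le_rfl ?_
      rw [Nat.mul_add, Nat.mul_add]
      dsimp only
      omega
    · have hn : 1 ≤ 2 ^ (2 * m) * q := Nat.mul_pos hpow hq
      have hl := h.1
      refine ⟨hn, 0, ?_⟩
      have h' := repeats_cons_iff (a := false).2 (h.iterate_mu (2 * m))
      refine ⟨by have := h'.1; dsimp only; omega, fun j _ hj => ?_⟩
      dsimp only at hj ⊢
      rcases j with _ | j
      · rw [show 0 + 2 ^ (2 * m) * q = 2 ^ (2 * m) * q - 1 + 1 by omega, List.getD_cons_succ,
          iterate_mu_getD_last m w q hq (by omega), hlast, List.getD_cons_zero]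
      · exact h'.2 (j + 1) (by omega) (by omega)

lemma zeroSquarePeriods_cons_mu (w : List Bool) (hw : w ≠ []) (h0 : w.getD 0 false = false) :
    zeroSquarePeriods (false :: mu w) = {1} := by
  have hlen : 1 ≤ w.length := List.length_pos_iff.2 hw
  ext n
  simp only [Set.mem_singleton_iff]
  constructor
  · rintro ⟨hn, h, hlast⟩
    have hl := h.1
    rw [List.length_cons, length_mu] at hl
    rcases Nat.mod_two_eq_zero_or_one n with hpar | hpar
    · exfalso
      obtain ⟨p, rfl⟩ : ∃ p, n = 2 * (p + 1) := ⟨n / 2 - 1, by omega⟩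
      have h1 := h.2 0 le_rfl (by omega)
      rw [show 0 + 2 * (p + 1) = 2 * p + 1 + 1 by ring, List.getD_cons_succ,
        mu_getD_odd _ _ (by omega)] at h1
      rw [show 2 * (p + 1) - 1 = 2 * p + 1 by omega, List.getD_cons_succ, mu_getD_even] at hlast
      rw [hlast] at h1
      simp at h1
    · by_contra hne
      have h1 := h.alternating hpar (cons_mu_blocks false w) 1 (by omega)
      rw [Nat.zero_add, show (1 : ℕ) = 2 * 0 + 1 by rfl, List.getD_cons_succ, mu_getD_even,
        h0] at h1
      simp at h1
  · rintro rfl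
    refine ⟨le_rfl, ⟨by rw [List.length_cons, length_mu]; omega, fun j _ hj => ?_⟩, rfl⟩
    obtain rfl : j = 0 := by omega
    rw [Nat.zero_add, show (1 : ℕ) = 2 * 0 + 1 by rfl, List.getD_cons_succ, mu_getD_even, h0]
    rfl

/-- Every repetition in `w` has exponent less than `7/3`. -/
def ShortRepeats (w : List Bool) : Prop :=
  ∀ n s e, 1 ≤ n → Repeats w n s e → 3 * (e - s) < 4 * n

lemma ShortRepeats.cons_iterate_mu {k : ℕ} (hk : 2 ≤ k) {w : List Bool} (hw : ShortRepeats w) :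
    ShortRepeats (false :: mu^[k] w) := by
  intro n s e hn h
  by_cases he : e - s ≤ n
  · omega
  obtain ⟨e, rfl⟩ : ∃ d, e = d + 1 := ⟨e - 1, by omega⟩
  rcases s with _ | s
  · have h' : Repeats (mu^[k] w) n 0 e := repeats_cons_iff.1 (h.mono (Nat.zero_le _) le_rfl)
    obtain ⟨q, s', e', rfl, hD, hr, -, -, -⟩ := h'.of_iterate_mu _ (Or.inr ⟨rfl, by omega⟩)
    have hq : 1 ≤ q := Nat.pos_of_mul_pos_left hn
    have h4 : 2 ^ 2 ≤ 2 ^ k := Nat.pow_le_pow_right (by norm_num) hk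
    have h3 := Nat.mul_le_mul_left (2 ^ k) (Nat.succ_le_of_lt (hw q s' e' hq hr))
    rw [Nat.succ_eq_add_one, Nat.mul_add, Nat.mul_left_comm, Nat.mul_left_comm _ 4] at h3
    omega
  · have h' : Repeats (mu^[k] w) n s e := repeats_cons_iff.1 h
    obtain ⟨q, s', e', rfl, hD, hr, -, -, -⟩ := h'.of_iterate_mu _ (Or.inl (by omega))
    have hq : 1 ≤ q := Nat.pos_of_mul_pos_left hn
    have h3 := Nat.mul_lt_mul_of_pos_left (hw q s' e' hq hr) (Nat.two_pow_pos k)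
    rw [Nat.mul_left_comm, Nat.mul_left_comm _ 4] at h3
    omega

lemma mu_append (v w : List Bool) : mu (v ++ w) = mu v ++ mu w := by
  simp [mu]

lemma mu_flatten (l : List (List Bool)) : mu l.flatten = (l.map mu).flatten := by
  induction l with
  | nil => rfl
  | cons v l ih => simp [mu_append, ih]

lemma R_cons (a : ℕ) (c : List ℕ) : R (a :: c) = g a ++ mu (R c) := by
  unfold R
  rw [mu_flatten, List.length_cons, List.range_succ_eq_map, List.map_cons, List.flatten_cons,
    List.map_map, List.map_map]
  congr 2
  refine List.map_congr_left fun i _ => ?_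
  simp only [Function.comp_apply, Nat.succ_eq_add_one, List.getD_cons_succ]
  rw [Function.iterate_succ_apply']

lemma HasPeriod.repeats_append {u : List Bool} {n : ℕ} (h : HasPeriod u n) (a b : List Bool) :
    Repeats (a ++ u ++ b) n a.length (a.length + (u.length - n)) := by
  obtain ⟨-, hl, h⟩ := h
  have key : ∀ i < u.length, (a ++ u ++ b).getD (a.length + i) false = u.getD i false := by
    intro i hi
    rw [List.append_assoc, List.getD_append_right _ _ _ _ (by omega),
      List.getD_append _ _ _ _ (by omega)]
    congr 1
    omega
  refine ⟨by simp only [List.length_append]; omega, fun j h1 h2 => ?_⟩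
  obtain ⟨i, rfl⟩ := Nat.exists_eq_add_of_le h1
  rw [Nat.add_assoc, key i (by omega), key (i + n) (by omega)]
  exact h i (by omega)

lemma Repeats.exists_factor {w : List Bool} {n s e : ℕ} (hn : 1 ≤ n) (h : Repeats w n s e)
    (hs : s ≤ e) : ∃ u, u <:+: w ∧ u.length = e - s + n ∧ HasPeriod u n := by
  have hl := h.1
  have hlen : ((w.drop s).take (e - s + n)).length = e - s + n := by
    rw [List.length_take, List.length_drop]; omega
  have key : ∀ i < e - s + n, ((w.drop s).take (e - s + n)).getD i false =
      w.getD (s + i) false := by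
    intro i hi
    simp [List.getD_eq_getElem?_getD, List.getElem?_drop, hi]
  refine ⟨(w.drop s).take (e - s + n),
    (List.take_prefix _ _).isInfix.trans (List.drop_suffix _ _).isInfix, hlen, hn, by omega,
    fun i hi => ?_⟩
  rw [hlen] at hi
  rw [key i (by omega), key (i + n) hi, ← Nat.add_assoc]
  exact h.2 (s + i) (by omega) (by omega)

lemma ShortRepeats.avoidsPow {w : List Bool} (hw : ShortRepeats w) : AvoidsPow (7 / 3) w := by
  rintro u hu ⟨a, b, rfl⟩
  have hpos : 1 ≤ u.length := List.length_pos_iff.2 hu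
  have hp : HasPeriod u (leastPeriod u) :=
    Nat.sInf_mem (s := {p | HasPeriod u p}) ⟨u.length, hpos, le_rfl, fun i hi => by omega⟩
  have h := hw _ _ _ hp.1 (hp.repeats_append a b)
  have h1 := hp.1
  unfold exponent
  rw [div_lt_div_iff₀ (by exact_mod_cast h1) (by norm_num)]
  have : u.length * 3 < 7 * leastPeriod u := by omega
  exact_mod_cast this

lemma setOf_overlap_factor (w : List Bool) :
    {n : ℕ | 1 ≤ n ∧ ∃ u : List Bool, u <:+: w ∧ u.length = 2 * n + 1 ∧ HasPeriod u n} =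
      overlapPeriods w := by
  ext n
  constructor
  · rintro ⟨hn, u, ⟨a, b, rfl⟩, hl, hp⟩
    exact ⟨hn, a.length, (hp.repeats_append a b).mono le_rfl (by omega)⟩
  · rintro ⟨hn, s, h⟩
    obtain ⟨u, hu, hl, hp⟩ := h.exists_factor hn (by omega)
    exact ⟨hn, u, hu, by omega, hp⟩

/-- The invariant satisfied by the words `R (2 :: b₁ ⋯ b_N)` with each `bᵢ` equal to `12` or
`1112`. -/
structure OverlapInvariant (w : List Bool) (N : ℕ) : Prop where
  ne_nil : w ≠ []
  head : w.getD 0 false = false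
  short : ShortRepeats w
  finite : (overlapPeriods w ∪ zeroSquarePeriods w).Finite
  ncard : (overlapPeriods w ∪ zeroSquarePeriods w).ncard = N

lemma OverlapInvariant.zero : OverlapInvariant [false] 0 := by
  have key : ∀ n s e, 1 ≤ n → Repeats [false] n s e → e = 0 := by
    intro n s e hn h
    have := h.1
    simp at this
    omega
  have hempty : overlapPeriods [false] ∪ zeroSquarePeriods [false] = ∅ := by
    ext n
    simp only [Set.mem_union, Set.mem_empty_iff_false, iff_false]
    rintro (⟨hn, s, h⟩ | ⟨hn, h, -⟩)
    · have := key _ _ _ hn h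
      omega
    · have := key _ _ _ hn h
      omega
  exact ⟨by simp, rfl, fun n s e hn h => by have := key n s e hn h; omega, by simp [hempty],
    by simp [hempty]⟩

lemma OverlapInvariant.cons_iterate_mu {w : List Bool} {N m : ℕ} (h : OverlapInvariant w N)
    (hm : 1 ≤ m) : OverlapInvariant (false :: mu^[2 * m] w) (N + 1) := by
  have hpos : 1 ≤ w.length := List.length_pos_iff.2 h.ne_nil
  have hz : zeroSquarePeriods (false :: mu^[2 * m] w) = {1} := by
    rw [show 2 * m = 2 * m - 1 + 1 by omega, Function.iterate_succ_apply']
    refine zeroSquarePeriods_cons_mu _ (List.length_pos_iff.1 ?_) ?_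
    · rw [length_iterate_mu]; positivity
    · rw [iterate_mu_getD_zero, h.head]
  have hinj : Function.Injective fun q : ℕ => 2 ^ (2 * m) * q :=
    fun a b hab => Nat.eq_of_mul_eq_mul_left (by positivity) hab
  have h1 : 1 ∉ (fun q => 2 ^ (2 * m) * q) '' (overlapPeriods w ∪ zeroSquarePeriods w) := by
    rintro ⟨q, -, hq⟩
    have := Nat.eq_one_of_mul_eq_one_right hq
    rw [Nat.pow_eq_one] at this
    omega
  have hfin := h.finite.image fun q => 2 ^ (2 * m) * q
  refine ⟨by simp, rfl, h.short.cons_iterate_mu (by omega), ?_, ?_⟩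
  · rw [overlapPeriods_cons_iterate_mu, hz]
    exact hfin.union (Set.finite_singleton 1)
  · rw [overlapPeriods_cons_iterate_mu, hz, Set.union_singleton,
      Set.ncard_insert_of_notMem h1 hfin, Set.ncard_image_of_injective _ hinj, h.ncard]

lemma overlapInvariant_R (bs : List (List ℕ)) (hbs : ∀ b ∈ bs, b = [1, 2] ∨ b = [1, 1, 1, 2]) :
    OverlapInvariant (R (2 :: bs.flatten)) bs.length := by
  induction bs with
  | nil => exact OverlapInvariant.zero
  | cons b bs ih =>
    have ih := ih fun b hb => hbs b (List.mem_cons_of_mem _ hb)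
    rw [List.length_cons, List.flatten_cons]
    rcases hbs b List.mem_cons_self with rfl | rfl
    · have := ih.cons_iterate_mu (m := 1) le_rfl
      rw [List.cons_append, List.cons_append, List.nil_append, R_cons, R_cons 1]
      exact this
    · have := ih.cons_iterate_mu (m := 2) (by norm_num)
      rw [List.cons_append, List.cons_append, List.cons_append, List.cons_append,
        List.nil_append, R_cons, R_cons 1, R_cons 1, R_cons 1]
      exact this

/-- For every i ≥ 0 and every code word c in the language 212{12,1112}^i, the
finite Restivo word R(c) avoids 7/3-powers and contains overlaps of exactly i
different periods. -/
theorem code_overlap_periods_finite (i : ℕ) (c : List ℕ)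
    (hc : ∃ bs : List (List ℕ), bs.length = i ∧
      (∀ b ∈ bs, b = [1, 2] ∨ b = [1, 1, 1, 2]) ∧ c = [2, 1, 2] ++ bs.flatten) :
    AvoidsPow (7/3) (R c) ∧
    {n : ℕ | 1 ≤ n ∧ ∃ u : List Bool, u <:+: R c ∧
        u.length = 2 * n + 1 ∧ HasPeriod u n}.Finite ∧
    {n : ℕ | 1 ≤ n ∧ ∃ u : List Bool, u <:+: R c ∧
        u.length = 2 * n + 1 ∧ HasPeriod u n}.ncard = i := by
  obtain ⟨bs, rfl, hbs, rfl⟩ := hc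
  have h := overlapInvariant_R bs hbs
  have hR : R ([2, 1, 2] ++ bs.flatten) = false :: mu^[2 * 1] (R (2 :: bs.flatten)) := by
    rw [List.cons_append, List.cons_append, List.cons_append, List.nil_append, R_cons, R_cons 1]
    rfl
  have hinj : Function.Injective fun q : ℕ => 2 ^ (2 * 1) * q :=
    fun a b hab => Nat.eq_of_mul_eq_mul_left (by positivity) hab
  rw [setOf_overlap_factor, hR, overlapPeriods_cons_iterate_mu]
  exact ⟨(h.short.cons_iterate_mu (by norm_num)).avoidsPow, h.finite.image _,
    by rw [Set.ncard_image_of_injective _ hinj, h.ncard]⟩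
end

section
/- Let ζ = (1 + √(5 + 4√3))/2. Then there exists a constant α > 0 such that E(2^n) ∼ α ζ^n as n → ∞; that is, E(2^n)/ζ^n converges to α. -/
/-- E(n): the number of binary words x of length n for which there exists an
infinite binary word y such that x·y is overlap-free. -/
noncomputable def E (n : ℕ) : ℕ :=
  Nat.card {x : List Bool // x.length = n ∧ ∃ y : ℕ → Bool, OverlapFreeSeq (appendSeq x y)}

/-- ζ = (1 + √(5 + 4√3))/2. -/
noncomputable def zeta : ℝ := (1 + Real.sqrt (5 + 4 * Real.sqrt 3)) / 2

/-- The infinite word obtained by prepending one letter. -/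
def consSeq (a : Bool) (w : ℕ → Bool) : ℕ → Bool
  | 0 => a
  | n + 1 => w n

/-- The infinite word with its first letter removed. -/
def tailSeq (w : ℕ → Bool) : ℕ → Bool := fun n => w (n + 1)

/-- The Thue–Morse morphism on infinite words. -/
def muSeq (w : ℕ → Bool) : ℕ → Bool := fun n => if n % 2 = 0 then w (n / 2) else !w (n / 2)

/-- `w` has an overlap of period `p` starting at position `i`. -/
def OverlapAt (w : ℕ → Bool) (i p : ℕ) : Prop := ∀ j ≤ p, w (i + j) = w (i + j + p)

/-- Overlap-freeness of infinite words, phrased with positions. -/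
def NoOverlap (w : ℕ → Bool) : Prop := ∀ i p, 1 ≤ p → ¬ OverlapAt w i p

@[simp] lemma consSeq_zero (a : Bool) (w : ℕ → Bool) : consSeq a w 0 = a := rfl

@[simp] lemma consSeq_succ (a : Bool) (w : ℕ → Bool) (n : ℕ) : consSeq a w (n + 1) = w n := rfl

lemma consSeq_consSeq_add_two (a b : Bool) (w : ℕ → Bool) (n : ℕ) :
    consSeq a (consSeq b w) (n + 2) = w n := rfl

@[simp] lemma tailSeq_apply (w : ℕ → Bool) (n : ℕ) : tailSeq w n = w (n + 1) := rfl

@[simp] lemma tailSeq_consSeq (a : Bool) (w : ℕ → Bool) : tailSeq (consSeq a w) = w := rfl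

lemma consSeq_tailSeq (w : ℕ → Bool) : consSeq (w 0) (tailSeq w) = w := by
  funext n
  cases n <;> rfl

lemma muSeq_even (w : ℕ → Bool) (k : ℕ) : muSeq w (2 * k) = w k := by
  simp [muSeq]

lemma muSeq_odd (w : ℕ → Bool) (k : ℕ) : muSeq w (2 * k + 1) = !w k := by
  have h : (2 * k + 1) / 2 = k := by omega
  simp [muSeq, h]

lemma muSeq_consSeq (a : Bool) (w : ℕ → Bool) :
    muSeq (consSeq a w) = consSeq a (consSeq (!a) (muSeq w)) := by
  funext n
  rcases n with _ | _ | n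
  · rfl
  · rfl
  · simp only [consSeq_succ, muSeq]
    rw [show (n + 1 + 1) % 2 = n % 2 by omega, show (n + 1 + 1) / 2 = n / 2 + 1 by omega]
    rfl

lemma consSeq_muSeq (a : Bool) (w : ℕ → Bool) :
    consSeq a (muSeq w) = tailSeq (muSeq (consSeq (!a) w)) := by
  rw [muSeq_consSeq, tailSeq_consSeq, Bool.not_not]

lemma muSeq_of_ne {w : ℕ → Bool} (h : ∀ k, w (2 * k) ≠ w (2 * k + 1)) :
    muSeq (fun k => w (2 * k)) = w := by
  funext n
  obtain ⟨k, rfl | rfl⟩ := Nat.even_or_odd' n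
  · rw [muSeq_even]
  · rw [muSeq_odd]
    have := h k
    revert this
    cases w (2 * k) <;> cases w (2 * k + 1) <;> simp

lemma NoOverlap.tail {w : ℕ → Bool} (h : NoOverlap w) : NoOverlap (tailSeq w) := by
  intro i p hp ho
  refine h (i + 1) p hp fun j hj => ?_
  have := ho j hj
  simp only [tailSeq_apply] at this
  rwa [show i + 1 + j = i + j + 1 by omega, show i + j + 1 + p = i + j + p + 1 by omega]

lemma NoOverlap.of_consSeq {a : Bool} {w : ℕ → Bool} (h : NoOverlap (consSeq a w)) :
    NoOverlap w := h.tail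

lemma NoOverlap.not_cube {w : ℕ → Bool} (h : NoOverlap w) (i : ℕ) :
    ¬ (w i = w (i + 1) ∧ w (i + 1) = w (i + 2)) := by
  rintro ⟨h1, h2⟩
  refine h i 1 le_rfl fun j hj => ?_
  interval_cases j <;> assumption

lemma NoOverlap.not_alternating {w : ℕ → Bool} (h : NoOverlap w) (i : ℕ) :
    ¬ (w i ≠ w (i + 1) ∧ w (i + 1) ≠ w (i + 2) ∧ w (i + 2) ≠ w (i + 3) ∧
      w (i + 3) ≠ w (i + 4)) := by
  rintro ⟨h0, h1, h2, h3⟩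
  refine h i 2 (by norm_num) fun j hj => ?_
  have key : ∀ a b c : Bool, a ≠ b → b ≠ c → a = c := by decide
  interval_cases j
  exacts [key _ _ _ h0 h1, key _ _ _ h1 h2, key _ _ _ h2 h3]

lemma NoOverlap.not_period_three {w : ℕ → Bool} (h : NoOverlap w) (i : ℕ) :
    ¬ (w i = w (i + 3) ∧ w (i + 1) = w (i + 4) ∧ w (i + 2) = w (i + 5) ∧
      w (i + 3) = w (i + 6)) := by
  rintro ⟨h0, h1, h2, h3⟩
  refine h i 3 (by norm_num) fun j hj => ?_
  interval_cases j <;> assumption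

lemma NoOverlap.of_tailSeq_muSeq {w : ℕ → Bool} (h : NoOverlap (tailSeq (muSeq w))) :
    NoOverlap w := by
  intro i q hq ho
  refine h (2 * i) (2 * q) (by omega) fun j hj => ?_
  obtain ⟨k, rfl | rfl⟩ := Nat.even_or_odd' j
  · have := ho k (by omega)
    simp only [tailSeq_apply]
    rw [show 2 * i + 2 * k + 1 = 2 * (i + k) + 1 by ring,
      show 2 * i + 2 * k + 2 * q + 1 = 2 * (i + k + q) + 1 by ring, muSeq_odd, muSeq_odd, this]
  · have := ho (k + 1) (by omega)
    simp only [tailSeq_apply]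
    rw [show 2 * i + (2 * k + 1) + 1 = 2 * (i + (k + 1)) by ring,
      show 2 * i + (2 * k + 1) + 2 * q + 1 = 2 * (i + (k + 1) + q) by ring,
      muSeq_even, muSeq_even, this]

lemma OverlapAt.of_muSeq_even_period {w : ℕ → Bool} {i q : ℕ}
    (h : OverlapAt (muSeq w) i (2 * q)) : OverlapAt w (i / 2) q := by
  intro j hj
  have := h (2 * j) (by omega)
  simp only [muSeq] at this
  rw [show (i + 2 * j) % 2 = i % 2 by omega, show (i + 2 * j + 2 * q) % 2 = i % 2 by omega,
    show (i + 2 * j) / 2 = i / 2 + j by omega,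
    show (i + 2 * j + 2 * q) / 2 = i / 2 + j + q by omega] at this
  split_ifs at this <;> simpa using this

lemma not_overlapAt_muSeq_one (w : ℕ → Bool) (i : ℕ) : ¬ OverlapAt (muSeq w) i 1 := by
  intro h
  have h0 := h 0 (by omega)
  have h1 := h 1 (by omega)
  obtain ⟨k, rfl | rfl⟩ := Nat.even_or_odd' i
  · simp only [add_zero, muSeq_even, muSeq_odd] at h0
    simp at h0
  · rw [show 2 * k + 1 + 1 = 2 * (k + 1) by ring, muSeq_even, muSeq_odd] at h1
    simp at h1

lemma OverlapAt.cube_of_muSeq_odd_period {w : ℕ → Bool} {i p : ℕ}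
    (h : OverlapAt (muSeq w) i p) (hp : 3 ≤ p) (hodd : p % 2 = 1) :
    ∃ k, w k = w (k + 1) ∧ w (k + 1) = w (k + 2) := by
  have h0 := h 0 (by omega)
  have h1 := h 1 (by omega)
  have h2 := h 2 (by omega)
  have h3 := h 3 (by omega)
  obtain ⟨q, rfl⟩ : ∃ q, p = 2 * q + 1 := ⟨p / 2, by omega⟩
  obtain ⟨k, rfl | rfl⟩ := Nat.even_or_odd' i
  · refine ⟨k + q, ?_⟩
    rw [show 2 * k + 0 + (2 * q + 1) = 2 * (k + q) + 1 by ring,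
      show 2 * k + 0 = 2 * k by ring, muSeq_even, muSeq_odd] at h0
    rw [show 2 * k + 1 + (2 * q + 1) = 2 * (k + q + 1) by ring, muSeq_even, muSeq_odd] at h1
    rw [show 2 * k + 2 + (2 * q + 1) = 2 * (k + q + 1) + 1 by ring,
      show 2 * k + 2 = 2 * (k + 1) by ring, muSeq_even, muSeq_odd] at h2
    rw [show 2 * k + 3 + (2 * q + 1) = 2 * (k + q + 2) by ring,
      show 2 * k + 3 = 2 * (k + 1) + 1 by ring, muSeq_even, muSeq_odd] at h3
    simp_all
  · refine ⟨k, ?_⟩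
    rw [show 2 * k + 1 + 0 + (2 * q + 1) = 2 * (k + q + 1) by ring,
      show 2 * k + 1 + 0 = 2 * k + 1 by ring, muSeq_even, muSeq_odd] at h0
    rw [show 2 * k + 1 + 1 + (2 * q + 1) = 2 * (k + q + 1) + 1 by ring,
      show 2 * k + 1 + 1 = 2 * (k + 1) by ring, muSeq_even, muSeq_odd] at h1
    rw [show 2 * k + 1 + 2 + (2 * q + 1) = 2 * (k + q + 2) by ring,
      show 2 * k + 1 + 2 = 2 * (k + 1) + 1 by ring, muSeq_even, muSeq_odd] at h2
    rw [show 2 * k + 1 + 3 + (2 * q + 1) = 2 * (k + q + 2) + 1 by ring,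
      show 2 * k + 1 + 3 = 2 * (k + 2) by ring, muSeq_even, muSeq_odd] at h3
    simp_all

lemma NoOverlap.mu {w : ℕ → Bool} (h : NoOverlap w) : NoOverlap (muSeq w) := by
  intro i p hp ho
  obtain ⟨q, rfl | rfl⟩ := Nat.even_or_odd' p
  · exact h _ q (by omega) ho.of_muSeq_even_period
  · rcases Nat.eq_zero_or_pos q with rfl | hq
    · exact not_overlapAt_muSeq_one w i ho
    · obtain ⟨k, hk⟩ := ho.cube_of_muSeq_odd_period (by omega) (by omega)
      exact h.not_cube k hk

lemma noOverlap_muSeq_iff {w : ℕ → Bool} : NoOverlap (muSeq w) ↔ NoOverlap w :=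
  ⟨fun h => h.tail.of_tailSeq_muSeq, NoOverlap.mu⟩

lemma noOverlap_consSeq_muSeq_iff {a : Bool} {w : ℕ → Bool} :
    NoOverlap (consSeq a (muSeq w)) ↔ NoOverlap (consSeq (!a) w) := by
  rw [consSeq_muSeq]
  exact ⟨NoOverlap.of_tailSeq_muSeq, fun h => h.mu.tail⟩

lemma noOverlap_consSeq_consSeq_muSeq_iff {a : Bool} {w : ℕ → Bool} :
    NoOverlap (consSeq a (consSeq a (muSeq w))) ↔
      NoOverlap (consSeq (!a) w) ∧ w 0 = (!a) ∧ w 1 = a ∧ w 2 = !a := by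
  constructor
  · intro h
    have h' := noOverlap_consSeq_muSeq_iff.1 h.of_consSeq
    have c0 := h.not_cube 0
    have c1 := h'.not_cube 0
    have c2 := h.not_period_three 0
    refine ⟨h', ?_⟩
    simp only [zero_add, consSeq_zero, consSeq_succ, muSeq] at c0 c1 c2
    norm_num at c0 c1 c2
    clear h h'
    generalize w 0 = x at *
    generalize w 1 = y at *
    generalize w 2 = z at *
    revert a x y z
    decide
  · rintro ⟨h, h0, h1, h2⟩ i p hp ho
    rcases i with _ | i
    · obtain ⟨q, rfl | rfl⟩ := Nat.even_or_odd' p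
      · obtain ⟨r, rfl⟩ : ∃ r, q = r + 1 := ⟨q - 1, by omega⟩
        have e0 := ho 0 (by omega)
        have e1 := ho 1 (by omega)
        rw [show 0 + 0 + 2 * (r + 1) = 2 * r + 2 by ring,
            consSeq_consSeq_add_two _ _ _ (2 * r),
          muSeq_even] at e0
        rw [show 0 + 1 + 2 * (r + 1) = 2 * r + 1 + 2 by ring,
            consSeq_consSeq_add_two _ _ _ (2 * r + 1),
          muSeq_odd] at e1
        simp only [zero_add, consSeq_zero, consSeq_succ] at e0 e1
        simp [← e0] at e1
      · rcases q with _ | _ | q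
        · have := ho 1 (by omega)
          simp [consSeq, muSeq, h0] at this
        · have := ho 3 (by omega)
          simp [consSeq, muSeq, h0, h2] at this
        · have e2 := ho 2 (by omega)
          have e3 := ho 3 (by omega)
          have e4 := ho 4 (by omega)
          have e5 := ho 5 (by omega)
          refine h.of_consSeq.not_cube (q + 2) ?_
          rw [show 0 + 2 + (2 * (q + 1 + 1) + 1) = 2 * (q + 2) + 1 + 2 by ring,
            consSeq_consSeq_add_two _ _ _ (2 * (q + 2) + 1), muSeq_odd] at e2
          rw [show 0 + 3 + (2 * (q + 1 + 1) + 1) = 2 * (q + 3) + 2 by ring,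
            consSeq_consSeq_add_two _ _ _ (2 * (q + 3)), muSeq_even] at e3
          rw [show 0 + 4 + (2 * (q + 1 + 1) + 1) = 2 * (q + 3) + 1 + 2 by ring,
            consSeq_consSeq_add_two _ _ _ (2 * (q + 3) + 1), muSeq_odd] at e4
          rw [show 0 + 5 + (2 * (q + 1 + 1) + 1) = 2 * (q + 4) + 2 by ring,
            consSeq_consSeq_add_two _ _ _ (2 * (q + 4)), muSeq_even] at e5
          simp [consSeq, muSeq] at e2 e3 e4 e5
          exact ⟨by simpa using e2.symm.trans e3, by simpa using e4.symm.trans e5⟩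
    · refine noOverlap_consSeq_muSeq_iff.2 h i p hp fun j hj => ?_
      have := ho j hj
      rwa [show i + 1 + j = i + j + 1 by omega, show i + j + 1 + p = i + j + p + 1 by omega] at this

lemma NoOverlap.exists_square {w : ℕ → Bool} (h : NoOverlap w) :
    ∃ i, 1 ≤ i ∧ w i = w (i + 1) := by
  by_contra! hne
  exact h.not_alternating 1
    ⟨hne 1 le_rfl, hne 2 (by omega), hne 3 (by omega), hne 4 (by omega)⟩

lemma NoOverlap.ne_add_one_of_square {w : ℕ → Bool} (h : NoOverlap w) {i : ℕ}
    (hi : w i = w (i + 1)) : w (i + 1) ≠ w (i + 2) :=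
  fun hc => h.not_cube i ⟨hi, hc⟩

lemma NoOverlap.ne_add_three_of_square {w : ℕ → Bool} (h : NoOverlap w) {i : ℕ}
    (hi : w (i + 1) = w (i + 2)) : w (i + 4) ≠ w (i + 5) := by
  intro hc
  have c0 := h.not_cube i
  have c1 := h.not_cube (i + 1)
  have c2 := h.not_cube (i + 2)
  have c3 := h.not_cube (i + 3)
  have c4 := h.not_cube (i + 4)
  have p0 := h.not_period_three i
  have p1 := h.not_period_three (i + 1)
  simp only [add_assoc, Nat.reduceAdd] at c1 c2 c3 c4 p1
  clear h
  generalize w i = x0 at *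
  generalize w (i + 1) = x1 at *
  generalize w (i + 2) = x2 at *
  generalize w (i + 3) = x3 at *
  generalize w (i + 4) = x4 at *
  generalize w (i + 5) = x5 at *
  generalize w (i + 6) = x6 at *
  generalize w (i + 7) = x7 at *
  revert x0 x1 x2 x3 x4 x5 x6 x7
  decide

lemma NoOverlap.square_add_two_or_add_four {w : ℕ → Bool} (h : NoOverlap w) {i : ℕ}
    (hi : w (i + 1) = w (i + 2)) : w (i + 3) = w (i + 4) ∨ w (i + 5) = w (i + 6) := by
  by_contra! hc
  exact h.not_alternating (i + 2)
    ⟨h.ne_add_one_of_square hi, hc.1, h.ne_add_three_of_square hi, hc.2⟩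

lemma NoOverlap.ne_of_square_of_odd_distance {w : ℕ → Bool} (h : NoOverlap w) {i : ℕ}
    (hi : w (i + 1) = w (i + 2)) (k : ℕ) :
    w (i + 2 * k + 2) ≠ w (i + 2 * k + 3) ∧
      (w (i + 2 * k + 1) = w (i + 2 * k + 2) ∨ w (i + 2 * k + 3) = w (i + 2 * k + 4)) := by
  induction k with
  | zero => exact ⟨h.ne_add_one_of_square hi, Or.inl hi⟩
  | succ k ih =>
    rw [show i + 2 * (k + 1) = i + 2 * k + 2 by ring]
    simp only [add_assoc, Nat.reduceAdd] at ih ⊢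
    simp only [← add_assoc] at ih ⊢
    rcases ih with ⟨-, hs | hs⟩
    · exact ⟨h.ne_add_three_of_square hs, h.square_add_two_or_add_four hs⟩
    · exact ⟨h.ne_add_one_of_square hs, Or.inl hs⟩

lemma NoOverlap.eq_muSeq_or {w : ℕ → Bool} (h : NoOverlap w) :
    (∃ v, w = muSeq v) ∨ (∃ a v, w = consSeq a (muSeq v)) ∨
      ∃ a v, w = consSeq a (consSeq a (muSeq v)) := by
  obtain ⟨i, hi, hs⟩ := h.exists_square
  have hodd : ∀ j m, 1 ≤ j → 1 ≤ m → w j = w (j + 1) → w m = w (m + 1) → j % 2 = m % 2 := by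
    have key : ∀ j m, 1 ≤ j → j ≤ m → w j = w (j + 1) → w m = w (m + 1) → j % 2 = m % 2 := by
      intro j m hj hjm hsj hsm
      by_contra hpar
      obtain ⟨j, rfl⟩ : ∃ j', j = j' + 1 := ⟨j - 1, by omega⟩
      obtain ⟨k, rfl⟩ : ∃ k, m = j + 2 * k + 2 := ⟨(m - j - 2) / 2, by omega⟩
      exact (h.ne_of_square_of_odd_distance hsj k).1 hsm
    intro j m hj hm hsj hsm
    rcases le_total j m with hjm | hjm
    · exact key j m hj hjm hsj hsm
    · exact (key m j hm hjm hsm hsj).symm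
  rcases Nat.mod_two_eq_zero_or_one i with hpar | hpar
  · refine Or.inr (Or.inl ⟨w 0, fun k => tailSeq w (2 * k), ?_⟩)
    rw [muSeq_of_ne, consSeq_tailSeq]
    intro k hk
    have := hodd i (2 * k + 1) hi (by omega) hs hk
    omega
  · have hne : ∀ k, w (2 * (k + 1)) ≠ w (2 * (k + 1) + 1) := by
      intro k hk
      have := hodd i (2 * (k + 1)) hi (by omega) hs hk
      omega
    by_cases h01 : w 0 = w 1
    · refine Or.inr (Or.inr ⟨w 0, fun k => tailSeq (tailSeq w) (2 * k), ?_⟩)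
      rw [muSeq_of_ne fun k => hne k]
      conv_lhs => rw [← consSeq_tailSeq w, ← consSeq_tailSeq (tailSeq w)]
      rw [tailSeq_apply, ← h01]
    · left
      refine ⟨fun k => w (2 * k), (muSeq_of_ne fun k => ?_).symm⟩
      rcases k with _ | k
      · exact h01
      · exact hne k

lemma thueMorse_eq_muSeq : thueMorse = muSeq thueMorse := by
  symm
  have h : ∀ k, thueMorse (2 * k) = thueMorse k := by
    intro k
    rcases Nat.eq_zero_or_pos k with rfl | hk
    · rfl
    · simp only [thueMorse]
      rw [Nat.digits_def' (by norm_num) (by omega)]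
      simp
  have h1 : ∀ k, thueMorse (2 * k + 1) = !thueMorse k := by
    intro k
    simp only [thueMorse]
    rw [Nat.digits_def' (by norm_num) (by omega), show (2 * k + 1) / 2 = k by omega,
      show (2 * k + 1) % 2 = 1 by omega, List.count_cons_self]
    rcases Nat.mod_two_eq_zero_or_one ((Nat.digits 2 k).count 1) with hc | hc <;>
      simp [Nat.add_mod, hc]
  funext n
  obtain ⟨k, rfl | rfl⟩ := Nat.even_or_odd' n
  · rw [muSeq_even, h]
  · rw [muSeq_odd, h1]

lemma noOverlap_thueMorse : NoOverlap thueMorse := by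
  have hrec := thueMorse_eq_muSeq
  have h1 : ∀ k, thueMorse (2 * k + 1) = !thueMorse k := fun k => by
    conv_lhs => rw [hrec, muSeq_odd]
  have h2 : ∀ k, thueMorse (2 * k) = thueMorse k := fun k => by
    conv_lhs => rw [hrec, muSeq_even]
  have cube : ∀ k, ¬ (thueMorse k = thueMorse (k + 1) ∧
      thueMorse (k + 1) = thueMorse (k + 2)) := by
    rintro k ⟨e1, e2⟩
    obtain ⟨m, rfl | rfl⟩ := Nat.even_or_odd' k
    · rw [h1, h2] at e1
      simp at e1
    · rw [show 2 * m + 1 + 1 = 2 * (m + 1) by ring,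
        show 2 * m + 1 + 2 = 2 * (m + 1) + 1 by ring, h1, h2] at e2
      simp at e2
  intro i p
  induction p using Nat.strong_induction_on generalizing i with
  | _ p ih =>
    intro hp ho
    obtain ⟨q, rfl | rfl⟩ := Nat.even_or_odd' p
    · rw [hrec] at ho
      exact ih q (by omega) _ (by omega) ho.of_muSeq_even_period
    · rw [hrec] at ho
      rcases Nat.eq_zero_or_pos q with rfl | hq
      · exact not_overlapAt_muSeq_one _ i ho
      · obtain ⟨k, hk⟩ := ho.cube_of_muSeq_odd_period (by omega) (by omega)
        exact cube k hk

/-- Overlap-free infinite words. -/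
def overlapFreeWords : Set (ℕ → Bool) := {w | NoOverlap w}

/-- Infinite words starting with `c` that stay overlap-free when `c` is prepended. -/
def sameExt (c : Bool) : Set (ℕ → Bool) := {w | NoOverlap (consSeq c w) ∧ w 0 = c}

/-- Infinite words starting with `!c` that stay overlap-free when `c` is prepended. -/
def flipExt (c : Bool) : Set (ℕ → Bool) := {w | NoOverlap (consSeq c w) ∧ w 0 = !c}

/-- Infinite words that stay overlap-free when `c` is prepended. -/
def leftExt (c : Bool) : Set (ℕ → Bool) := {w | NoOverlap (consSeq c w)}

/-- Infinite words starting with `!c, !c` that stay overlap-free when `c` is prepended. -/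
def flipTwoExt (c : Bool) : Set (ℕ → Bool) := {w | NoOverlap (consSeq c w) ∧ w 0 = (!c) ∧ w 1 = !c}

/-- Infinite words starting with `c, !c, c` that stay overlap-free when `c` is prepended. -/
def altExt (c : Bool) : Set (ℕ → Bool) :=
  {w | NoOverlap (consSeq c w) ∧ w 0 = c ∧ w 1 = (!c) ∧ w 2 = c}

lemma noOverlap_consSeq_consSeq_muSeq_iff_mem {a : Bool} {w : ℕ → Bool} :
    NoOverlap (consSeq a (consSeq a (muSeq w))) ↔ w ∈ altExt (!a) := by
  rw [noOverlap_consSeq_consSeq_muSeq_iff]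
  simp [altExt]

lemma overlapFreeWords_eq : overlapFreeWords = muSeq '' overlapFreeWords ∪
    ((consSeq false ∘ muSeq) '' leftExt true ∪ (consSeq true ∘ muSeq) '' leftExt false ∪
      ((consSeq false ∘ consSeq false ∘ muSeq) '' altExt true ∪
        (consSeq true ∘ consSeq true ∘ muSeq) '' altExt false)) := by
  ext w
  constructor
  · intro h
    rcases NoOverlap.eq_muSeq_or h with ⟨v, rfl⟩ | ⟨a, v, rfl⟩ | ⟨a, v, rfl⟩
    · exact Or.inl ⟨v, noOverlap_muSeq_iff.1 h, rfl⟩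
    · have := noOverlap_consSeq_muSeq_iff.1 h
      cases a
      · exact Or.inr (Or.inl (Or.inl ⟨v, this, rfl⟩))
      · exact Or.inr (Or.inl (Or.inr ⟨v, this, rfl⟩))
    · have := noOverlap_consSeq_consSeq_muSeq_iff_mem.1 h
      cases a
      · exact Or.inr (Or.inr (Or.inl ⟨v, this, rfl⟩))
      · exact Or.inr (Or.inr (Or.inr ⟨v, this, rfl⟩))
  · rintro (⟨v, h, rfl⟩ | ((⟨v, h, rfl⟩ | ⟨v, h, rfl⟩) | (⟨v, h, rfl⟩ | ⟨v, h, rfl⟩)))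
    · exact noOverlap_muSeq_iff.2 h
    · exact noOverlap_consSeq_muSeq_iff.2 h
    · exact noOverlap_consSeq_muSeq_iff.2 h
    · exact noOverlap_consSeq_consSeq_muSeq_iff_mem.2 h
    · exact noOverlap_consSeq_consSeq_muSeq_iff_mem.2 h

lemma leftExt_eq (c : Bool) : leftExt c = sameExt c ∪ flipExt c := by
  ext w
  simp only [leftExt, sameExt, flipExt, Set.mem_union, Set.mem_ofPred_eq]
  cases c <;> cases w 0 <;> simp

lemma not_noOverlap_consSeq_not_square_muSeq (a : Bool) (v : ℕ → Bool) :
    ¬ NoOverlap (consSeq (!a) (consSeq a (consSeq a (muSeq v)))) := by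
  intro h
  obtain ⟨-, h0, h1, h2⟩ := noOverlap_consSeq_consSeq_muSeq_iff.1 h.of_consSeq
  refine h.not_period_three 0 ?_
  simp [consSeq, muSeq, h0, h1]

lemma noOverlap_consSeq_not_consSeq_muSeq_iff {a : Bool} {v : ℕ → Bool} :
    NoOverlap (consSeq a (consSeq (!a) (muSeq v))) ↔ NoOverlap (consSeq a v) := by
  rw [← muSeq_consSeq, noOverlap_muSeq_iff]

/-- The decomposition of a word that stays overlap-free when `c` is prepended. -/
lemma eq_of_noOverlap_consSeq {c : Bool} {w : ℕ → Bool} (h : NoOverlap (consSeq c w)) :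
    (∃ v, w = muSeq v ∧ v ∈ leftExt (!c)) ∨ (∃ v, w = consSeq c (muSeq v) ∧ v ∈ altExt (!c)) ∨
      ∃ v, w = consSeq (!c) (muSeq v) ∧ v ∈ leftExt c := by
  rcases h.of_consSeq.eq_muSeq_or with ⟨v, rfl⟩ | ⟨a, v, rfl⟩ | ⟨a, v, rfl⟩
  · exact Or.inl ⟨v, rfl, noOverlap_consSeq_muSeq_iff.1 h⟩
  · by_cases ha : a = c
    · subst ha
      exact Or.inr (Or.inl ⟨v, rfl, noOverlap_consSeq_consSeq_muSeq_iff_mem.1 h⟩)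
    · obtain rfl : a = !c := (by decide : ∀ x y : Bool, x ≠ y → x = !y) _ _ ha
      exact Or.inr (Or.inr ⟨v, rfl, noOverlap_consSeq_not_consSeq_muSeq_iff.1 h⟩)
  · exfalso
    by_cases ha : a = c
    · subst ha
      exact h.not_cube 0 (by simp [consSeq])
    · obtain rfl : c = !a := (by decide : ∀ x y : Bool, x ≠ y → y = !x) _ _ ha
      exact not_noOverlap_consSeq_not_square_muSeq a v h

lemma sameExt_eq (c : Bool) :
    sameExt c = muSeq '' flipExt (!c) ∪ (consSeq c ∘ muSeq) '' altExt (!c) := by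
  ext w
  constructor
  · rintro ⟨h, h0⟩
    rcases eq_of_noOverlap_consSeq h with ⟨v, rfl, hv⟩ | ⟨v, rfl, hv⟩ | ⟨v, rfl, hv⟩
    · exact Or.inl ⟨v, ⟨hv, by simpa [muSeq] using h0⟩, rfl⟩
    · exact Or.inr ⟨v, hv, rfl⟩
    · simp at h0
  · rintro (⟨v, ⟨hv, h0⟩, rfl⟩ | ⟨v, hv, rfl⟩)
    · exact ⟨noOverlap_consSeq_muSeq_iff.2 hv, by simpa [muSeq] using h0⟩
    · exact ⟨noOverlap_consSeq_consSeq_muSeq_iff_mem.2 hv, rfl⟩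

lemma flipExt_eq (c : Bool) :
    flipExt c = muSeq '' sameExt (!c) ∪ (consSeq (!c) ∘ muSeq) '' leftExt c := by
  ext w
  constructor
  · rintro ⟨h, h0⟩
    rcases eq_of_noOverlap_consSeq h with ⟨v, rfl, hv⟩ | ⟨v, rfl, hv⟩ | ⟨v, rfl, hv⟩
    · exact Or.inl ⟨v, ⟨hv, by simpa [muSeq] using h0⟩, rfl⟩
    · simp at h0
    · exact Or.inr ⟨v, hv, rfl⟩
  · rintro (⟨v, ⟨hv, h0⟩, rfl⟩ | ⟨v, hv, rfl⟩)
    · exact ⟨noOverlap_consSeq_muSeq_iff.2 hv, by simpa [muSeq] using h0⟩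
    · exact ⟨noOverlap_consSeq_not_consSeq_muSeq_iff.2 hv, rfl⟩

lemma flipTwoExt_eq (c : Bool) : flipTwoExt c = (consSeq (!c) ∘ muSeq) '' flipExt c := by
  ext w
  constructor
  · rintro ⟨h, h0, h1⟩
    rcases eq_of_noOverlap_consSeq h with ⟨v, rfl, hv⟩ | ⟨v, rfl, hv⟩ | ⟨v, rfl, hv⟩
    · rw [muSeq_odd v 0] at h1
      rw [muSeq_even v 0] at h0
      simp [h0] at h1
    · simp at h0
    · exact ⟨v, ⟨hv, by simpa [consSeq, muSeq] using h1⟩, rfl⟩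
  · rintro ⟨v, ⟨hv, h0⟩, rfl⟩
    exact ⟨noOverlap_consSeq_not_consSeq_muSeq_iff.2 hv, rfl, by simpa [consSeq, muSeq] using h0⟩

lemma altExt_eq (c : Bool) :
    altExt c = muSeq '' flipTwoExt (!c) ∪ (consSeq c ∘ muSeq) '' altExt (!c) := by
  ext w
  constructor
  · rintro ⟨h, h0, h1, h2⟩
    rcases eq_of_noOverlap_consSeq h with ⟨v, rfl, hv⟩ | ⟨v, rfl, hv⟩ | ⟨v, rfl, hv⟩
    · exact Or.inl ⟨v, ⟨hv, by simpa [muSeq] using h0, by simpa [muSeq] using h2⟩, rfl⟩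
    · exact Or.inr ⟨v, hv, rfl⟩
    · simp at h0
  · rintro (⟨v, ⟨hv, h0, h1⟩, rfl⟩ | ⟨v, hv, rfl⟩)
    · refine ⟨noOverlap_consSeq_muSeq_iff.2 hv, ?_⟩
      simp only [Bool.not_not] at h0 h1
      simp [muSeq, h0, h1]
    · refine ⟨noOverlap_consSeq_consSeq_muSeq_iff_mem.2 hv, rfl, ?_⟩
      simp [consSeq, muSeq, hv.2.1]

/-- The number of words of length `n` that are prefixes of a word in `C`. -/
noncomputable def prefixCount (C : Set (ℕ → Bool)) (n : ℕ) : ℕ :=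
  ((fun (w : ℕ → Bool) (i : Fin n) => w i) '' C).ncard

lemma prefixCount_pos {C : Set (ℕ → Bool)} (hC : C.Nonempty) (n : ℕ) : 0 < prefixCount C n :=
  (Set.ncard_pos (Set.toFinite _)).2 (hC.image _)

lemma prefixCount_union {C D : Set (ℕ → Bool)} {n : ℕ}
    (h : ∀ v ∈ C, ∀ w ∈ D, ∃ i < n, v i ≠ w i) :
    prefixCount (C ∪ D) n = prefixCount C n + prefixCount D n := by
  unfold prefixCount
  rw [Set.image_union]
  refine Set.ncard_union_eq (Set.disjoint_left.2 ?_) (Set.toFinite _) (Set.toFinite _)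
  rintro _ ⟨v, hv, rfl⟩ ⟨w, hw, hvw⟩
  obtain ⟨i, hi, hne⟩ := h v hv w hw
  exact hne (congrFun hvw ⟨i, hi⟩).symm

lemma prefixCount_image {g : (ℕ → Bool) → ℕ → Bool} {n k : ℕ}
    (hg : ∀ v w, (∀ i < n, g v i = g w i) ↔ ∀ i < k, v i = w i) (C : Set (ℕ → Bool)) :
    prefixCount (g '' C) n = prefixCount C k := by
  let pad : (Fin k → Bool) → ℕ → Bool := fun f i => if h : i < k then f ⟨i, h⟩ else false
  have hpad : ∀ f (i : Fin k), pad f i = f i := fun f i => by simp [pad]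
  let F : (Fin k → Bool) → Fin n → Bool := fun f i => g (pad f) i
  have hF : Function.Injective F := by
    intro f f' hff
    have := (hg (pad f) (pad f')).1 fun i hi => congrFun hff ⟨i, hi⟩
    funext i
    rw [← hpad f, ← hpad f', this i i.2]
  unfold prefixCount
  rw [← Set.ncard_image_of_injective _ hF, Set.image_image, Set.image_image]
  congr 1
  refine Set.image_congr fun w _ => ?_
  funext i
  exact (hg _ _).2 (fun j hj => by simp [pad, hj]) i i.2

lemma muSeq_agree_iff (n : ℕ) (v w : ℕ → Bool) :
    (∀ i < n, muSeq v i = muSeq w i) ↔ ∀ i < (n + 1) / 2, v i = w i := by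
  constructor
  · intro h i hi
    simpa [muSeq_even] using h (2 * i) (by omega)
  · intro h i hi
    simp only [muSeq]
    rw [h (i / 2) (by omega)]

lemma consSeq_agree_iff (a : Bool) (n : ℕ) (v w : ℕ → Bool) :
    (∀ i < n + 1, consSeq a v i = consSeq a w i) ↔ ∀ i < n, v i = w i := by
  constructor
  · intro h i hi
    exact h (i + 1) (by omega)
  · rintro h (_ | i) hi
    · rfl
    · exact h i (by omega)

lemma prefixCount_muSeq (C : Set (ℕ → Bool)) (n : ℕ) :
    prefixCount (muSeq '' C) n = prefixCount C ((n + 1) / 2) :=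
  prefixCount_image (muSeq_agree_iff n) C

lemma prefixCount_consSeq_muSeq (a : Bool) (C : Set (ℕ → Bool)) {n : ℕ} (hn : 1 ≤ n) :
    prefixCount ((consSeq a ∘ muSeq) '' C) n = prefixCount C (n / 2) := by
  obtain ⟨n, rfl⟩ : ∃ m, n = m + 1 := ⟨n - 1, by omega⟩
  exact prefixCount_image (fun v w => (consSeq_agree_iff a n _ _).trans (muSeq_agree_iff n v w)) C

lemma prefixCount_consSeq_consSeq_muSeq (a : Bool) (C : Set (ℕ → Bool)) {n : ℕ} (hn : 2 ≤ n) :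
    prefixCount ((consSeq a ∘ consSeq a ∘ muSeq) '' C) n = prefixCount C ((n - 1) / 2) := by
  obtain ⟨n, rfl⟩ : ∃ m, n = m + 1 + 1 := ⟨n - 2, by omega⟩
  exact prefixCount_image (fun v w => (consSeq_agree_iff a (n + 1) _ _).trans
    ((consSeq_agree_iff a n _ _).trans (muSeq_agree_iff n v w))) C

lemma muSeq_ne_consSeq_muSeq {a : Bool} {v w : ℕ → Bool} {n : ℕ} (hn : 6 ≤ n)
    (h : NoOverlap (muSeq v)) : ∃ i < n, muSeq v i ≠ consSeq a (muSeq w) i := by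
  by_contra! hc
  have h1 := hc 1 (by omega)
  have h2 := hc 2 (by omega)
  have h3 := hc 3 (by omega)
  have h4 := hc 4 (by omega)
  refine h.not_alternating 0 ?_
  simp [consSeq, muSeq] at h1 h2 h3 h4 ⊢
  simp_all

lemma muSeq_ne_consSeq_consSeq_muSeq {a : Bool} {v w : ℕ → Bool} {n : ℕ} (hn : 6 ≤ n) :
    ∃ i < n, muSeq v i ≠ consSeq a (consSeq a (muSeq w)) i := by
  by_contra! hc
  have h0 := hc 0 (by omega)
  have h1 := hc 1 (by omega)
  simp [consSeq, muSeq] at h0 h1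
  simp_all

lemma consSeq_muSeq_ne_consSeq_consSeq_muSeq {a b : Bool} {v w : ℕ → Bool} {n : ℕ}
    (hn : 6 ≤ n) (h : NoOverlap (consSeq a (muSeq v))) :
    ∃ i < n, consSeq a (muSeq v) i ≠ consSeq b (consSeq b (muSeq w)) i := by
  by_contra! hc
  have h1 := hc 1 (by omega)
  have h2 := hc 2 (by omega)
  have h3 := hc 3 (by omega)
  have h4 := hc 4 (by omega)
  have h5 := hc 5 (by omega)
  refine h.not_alternating 1 ?_
  simp [consSeq, muSeq] at h1 h2 h3 h4 h5 ⊢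
  simp_all

lemma prefixCount_sameExt (c : Bool) {n : ℕ} (hn : 6 ≤ n) : prefixCount (sameExt c) n =
    prefixCount (flipExt (!c)) ((n + 1) / 2) + prefixCount (altExt (!c)) (n / 2) := by
  rw [sameExt_eq, prefixCount_union, prefixCount_muSeq, prefixCount_consSeq_muSeq _ _ (by omega)]
  rintro _ ⟨v, hv, rfl⟩ _ ⟨w, -, rfl⟩
  exact muSeq_ne_consSeq_muSeq hn hv.1.of_consSeq.mu

lemma prefixCount_flipExt (c : Bool) {n : ℕ} (hn : 6 ≤ n) : prefixCount (flipExt c) n =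
    prefixCount (sameExt (!c)) ((n + 1) / 2) + prefixCount (leftExt c) (n / 2) := by
  rw [flipExt_eq, prefixCount_union, prefixCount_muSeq, prefixCount_consSeq_muSeq _ _ (by omega)]
  rintro _ ⟨v, hv, rfl⟩ _ ⟨w, -, rfl⟩
  exact muSeq_ne_consSeq_muSeq hn hv.1.of_consSeq.mu

lemma prefixCount_altExt (c : Bool) {n : ℕ} (hn : 6 ≤ n) : prefixCount (altExt c) n =
    prefixCount (flipTwoExt (!c)) ((n + 1) / 2) + prefixCount (altExt (!c)) (n / 2) := by
  rw [altExt_eq, prefixCount_union, prefixCount_muSeq, prefixCount_consSeq_muSeq _ _ (by omega)]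
  rintro _ ⟨v, hv, rfl⟩ _ ⟨w, -, rfl⟩
  exact muSeq_ne_consSeq_muSeq hn hv.1.of_consSeq.mu

lemma prefixCount_flipTwoExt (c : Bool) {n : ℕ} (hn : 6 ≤ n) :
    prefixCount (flipTwoExt c) n = prefixCount (flipExt c) (n / 2) := by
  rw [flipTwoExt_eq, prefixCount_consSeq_muSeq _ _ (by omega)]

lemma prefixCount_leftExt (c : Bool) {n : ℕ} (hn : 1 ≤ n) :
    prefixCount (leftExt c) n = prefixCount (sameExt c) n + prefixCount (flipExt c) n := by
  rw [leftExt_eq, prefixCount_union]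
  intro v hv w hw
  exact ⟨0, by omega, by simp [hv.2, hw.2]⟩

lemma prefixCount_overlapFreeWords {n : ℕ} (hn : 6 ≤ n) : prefixCount overlapFreeWords n =
    prefixCount overlapFreeWords ((n + 1) / 2) +
      (prefixCount (leftExt true) (n / 2) + prefixCount (leftExt false) (n / 2) +
        (prefixCount (altExt true) ((n - 1) / 2) + prefixCount (altExt false) ((n - 1) / 2))) := by
  conv_lhs => rw [overlapFreeWords_eq]
  rw [prefixCount_union, prefixCount_union, prefixCount_union, prefixCount_union,
    prefixCount_muSeq, prefixCount_consSeq_muSeq _ _ (by omega),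
    prefixCount_consSeq_muSeq _ _ (by omega),
    prefixCount_consSeq_consSeq_muSeq _ _ (by omega),
    prefixCount_consSeq_consSeq_muSeq _ _ (by omega)]
  · rintro _ ⟨v, hv, rfl⟩ _ ⟨w, -, rfl⟩
    exact ⟨0, by omega, by simp⟩
  · rintro _ ⟨v, hv, rfl⟩ _ ⟨w, -, rfl⟩
    exact ⟨0, by omega, by simp⟩
  · rintro _ (⟨v, hv, rfl⟩ | ⟨v, hv, rfl⟩) _ (⟨w, -, rfl⟩ | ⟨w, -, rfl⟩) <;>
      exact consSeq_muSeq_ne_consSeq_consSeq_muSeq hn (noOverlap_consSeq_muSeq_iff.2 hv)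
  · rintro _ ⟨v, hv, rfl⟩ _ ((⟨w, -, rfl⟩ | ⟨w, -, rfl⟩) | (⟨w, -, rfl⟩ | ⟨w, -, rfl⟩))
    · exact muSeq_ne_consSeq_muSeq hn (noOverlap_muSeq_iff.2 hv)
    · exact muSeq_ne_consSeq_muSeq hn (noOverlap_muSeq_iff.2 hv)
    · exact muSeq_ne_consSeq_consSeq_muSeq hn
    · exact muSeq_ne_consSeq_consSeq_muSeq hn

lemma overlapFreeSeq_iff {w : ℕ → Bool} : OverlapFreeSeq w ↔ NoOverlap w := by
  constructor
  · intro h i p hp ho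
    obtain ⟨k, rfl⟩ : ∃ k, p = k + 1 := ⟨p - 1, by omega⟩
    let x : List Bool := List.ofFn fun j : Fin k => w (i + 1 + j)
    refine h ([w i] ++ x ++ [w i] ++ x ++ [w i]) ⟨i, fun j hj => ?_⟩ ⟨w i, x, rfl⟩
    have hx : x.length = k := by simp [x]
    have hlen : ([w i] ++ x ++ [w i] ++ x ++ [w i]).length = 2 * k + 3 := by
      simp [hx]
      omega
    have h0 : w (i + (k + 1)) = w i := (ho 0 (by omega)).symm
    have h1 : w (i + (2 * k + 2)) = w i := by
      have := ho (k + 1) le_rfl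
      rw [show i + (2 * k + 2) = i + (k + 1) + (k + 1) by ring, ← this, h0]
    rw [hlen] at hj
    have hget : ∀ m (hm : m < x.length), x[m] = w (i + 1 + m) := fun m hm => by simp [x]
    simp only [List.get_eq_getElem, List.getElem_append, List.length_append, List.length_cons,
      List.length_nil, hx, List.getElem_singleton, hget]
    split_ifs with c1 c2 c3 c4
    · rw [show j = 0 by omega, add_zero]
    · congr 1
      omega
    · rw [show j = k + 1 by omega, h0]
    · have := ho (j - (k + 1)) (by omega)
      rw [show i + (j - (k + 1)) + (k + 1) = i + j by omega] at this
      rw [← this]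
      congr 1
      omega
    · rw [show j = 2 * k + 2 by omega, h1]
  · rintro h u ⟨i, hu⟩ ⟨a, x, rfl⟩
    refine h i (x.length + 1) (by omega) fun j hj => ?_
    have e1 := hu j (by simp; omega)
    have e2 := hu (j + (x.length + 1)) (by simp; omega)
    rw [add_assoc, ← e1, ← e2]
    simp only [List.get_eq_getElem, List.getElem_append, List.length_append, List.length_cons,
      List.length_nil, List.getElem_singleton]
    split_ifs <;> first | rfl | omega | (congr 1; omega)

lemma E_eq_prefixCount (n : ℕ) : E n = prefixCount overlapFreeWords n := by
  unfold E prefixCount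
  rw [← Set.ncard_image_of_injective _ (List.ofFn_injective (n := n))]
  change Set.ncard {x : List Bool | x.length = n ∧ ∃ y, OverlapFreeSeq (appendSeq x y)} = _
  congr 1
  ext x
  constructor
  · rintro ⟨rfl, y, hy⟩
    refine ⟨_, ⟨appendSeq x y, overlapFreeSeq_iff.1 hy, rfl⟩, ?_⟩
    refine List.ext_getElem (by simp) fun j h1 h2 => ?_
    simp [appendSeq]
  · rintro ⟨_, ⟨w, hw, rfl⟩, rfl⟩
    refine ⟨by simp, fun j => w (j + n), overlapFreeSeq_iff.2 ?_⟩
    have happ : appendSeq (List.ofFn fun i : Fin n => w i) (fun j => w (j + n)) = w := by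
      funext j
      by_cases hj : j < n
      · simp [appendSeq, hj]
      · simp [appendSeq, hj, Nat.sub_add_cancel (not_lt.1 hj)]
    exact happ.symm ▸ hw

lemma zeta_sq : zeta ^ 2 = zeta + 1 + √3 := by
  have h := Real.sq_sqrt (show (0 : ℝ) ≤ 5 + 4 * √3 by positivity)
  unfold zeta
  linear_combination h / 4

lemma two_lt_zeta : 2 < zeta := by
  have h3 : (1.7 : ℝ) < √3 := Real.lt_sqrt_of_sq_lt (by norm_num)
  have h : (3 : ℝ) < √(5 + 4 * √3) := Real.lt_sqrt_of_sq_lt (by linarith)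
  unfold zeta
  linarith

lemma zeta_lt_three : zeta < 3 := by
  have h3 : √3 < 2 := by
    rw [Real.sqrt_lt' (by norm_num)]
    norm_num
  have h : √(5 + 4 * √3) < 5 := by
    rw [Real.sqrt_lt' (by norm_num)]
    linarith
  unfold zeta
  linarith

open Asymptotics

lemma isBigO_two_pow_of_first_order {r : ℕ → ℝ} {κ : ℝ} (hκ : |κ| < 2)
    (h : (fun n => r (n + 1) - κ * r n) =O[⊤] fun n : ℕ => (2 : ℝ) ^ n) :
    r =O[⊤] fun n : ℕ => (2 : ℝ) ^ n := by
  obtain ⟨C, hC⟩ := isBigO_top.1 h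
  set D := max |r 0| (C / (2 - |κ|)) with hD
  have hCD : C ≤ (2 - |κ|) * D := by
    rw [mul_comm, ← div_le_iff₀ (by linarith)]
    exact le_max_right _ _
  refine isBigO_top.2 ⟨D, fun n => ?_⟩
  induction n with
  | zero => simp [hD]
  | succ n ih =>
    have hn := hC n
    simp only [norm_pow, Real.norm_ofNat, Real.norm_eq_abs] at hn ih ⊢
    have hpos : (0 : ℝ) < 2 ^ n := by positivity
    calc |r (n + 1)| = |(r (n + 1) - κ * r n) + κ * r n| := by rw [sub_add_cancel]
      _ ≤ |r (n + 1) - κ * r n| + |κ| * |r n| := by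
        rw [← abs_mul]
        exact abs_add_le _ _
      _ ≤ C * 2 ^ n + |κ| * (D * 2 ^ n) := by gcongr
      _ ≤ (2 - |κ|) * D * 2 ^ n + |κ| * (D * 2 ^ n) := by gcongr
      _ = D * 2 ^ (n + 1) := by ring

lemma isBigO_two_pow_of_second_order {h : ℕ → ℝ} {b : ℝ} (hb : |b| ≤ 2)
    (hrec : ∀ n, h (n + 2) = h (n + 1) + b * h n) :
    h =O[⊤] fun n : ℕ => (2 : ℝ) ^ n := by
  have key : ∀ n, |h n| ≤ (|h 0| + |h 1|) * 2 ^ n ∧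
      |h (n + 1)| ≤ (|h 0| + |h 1|) * 2 ^ (n + 1) := by
    intro n
    have h0 := abs_nonneg (h 0)
    have h1 := abs_nonneg (h 1)
    induction n with
    | zero => exact ⟨by norm_num, by
        norm_num
        linarith⟩
    | succ n ih =>
      refine ⟨ih.2, ?_⟩
      calc |h (n + 2)| ≤ |h (n + 1)| + |b| * |h n| := by
            rw [hrec, ← abs_mul]
            exact abs_add_le _ _
        _ ≤ (|h 0| + |h 1|) * 2 ^ (n + 1) + 2 * ((|h 0| + |h 1|) * 2 ^ n) := by
            gcongr
            exacts [ih.2, ih.1]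
        _ = (|h 0| + |h 1|) * 2 ^ (n + 1 + 1) := by ring
  refine isBigO_top.2 ⟨|h 0| + |h 1|, fun n => ?_⟩
  simpa using (key n).1

lemma isBigO_two_pow_shift {r : ℕ → ℝ} (h : r =O[⊤] fun n : ℕ => (2 : ℝ) ^ n) (k : ℕ) :
    (fun n => r (n + k)) =O[⊤] fun n : ℕ => (2 : ℝ) ^ n := by
  obtain ⟨C, hC⟩ := isBigO_top.1 h
  refine isBigO_top.2 ⟨C * 2 ^ k, fun n => (hC (n + k)).trans_eq ?_⟩
  simp only [norm_pow, Real.norm_ofNat]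
  ring

lemma tendsto_div_zeta_pow {x : ℕ → ℝ} {b : ℝ}
    (h : (fun n => x n - b * zeta ^ n) =O[⊤] fun n : ℕ => (2 : ℝ) ^ n) :
    Filter.Tendsto (fun n => x n / zeta ^ n) Filter.atTop (nhds b) := by
  have hz := two_lt_zeta
  have hlit : (fun n : ℕ => (2 : ℝ) ^ n) =o[Filter.atTop] fun n : ℕ => zeta ^ n :=
    isLittleO_pow_pow_of_lt_left (by norm_num) hz
  have ht := ((h.mono le_top).trans_isLittleO hlit).tendsto_div_nhds_zero.add_const b
  rw [zero_add] at ht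
  refine ht.congr fun n => ?_
  have : zeta ^ n ≠ 0 := pow_ne_zero _ (by linarith)
  field_simp
  ring

lemma exists_isBigO_sub_zeta_pow {y z w v : ℕ → ℝ}
    (hy : ∀ n, y (n + 1) = z n + y n) (hz : ∀ n, z (n + 1) = w n)
    (hw : ∀ n, w (n + 1) = 2 * v n + w n) (hv : ∀ n, v (n + 1) = w n + y n)
    (hy0 : 0 ≤ y 0) (hz0 : 0 ≤ z 0) (hw0 : 0 < w 0) (hv0 : 0 ≤ v 0) :
    ∃ a, 0 < a ∧ (fun n => y n - a * zeta ^ n) =O[⊤] fun n : ℕ => (2 : ℝ) ^ n := by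
  have hζ2 := two_lt_zeta
  have hζ3 := zeta_lt_three
  have hζsq := zeta_sq
  have h3 : √3 ^ 2 = (3 : ℝ) := Real.sq_sqrt (by norm_num)
  have h3l : 1 < √3 := Real.lt_sqrt_of_sq_lt (by norm_num)
  have h3u : √3 < 2 := by nlinarith
  generalize √3 = k at *
  generalize zeta = ζ at *
  let L : ℕ → ℝ := fun n => 2 * ζ * y n + 2 * z n + ζ ^ 2 * (ζ - 1) * w n +
    2 * ζ * (ζ - 1) * v n
  have hL : ∀ n, L (n + 1) = ζ * L n := by
    intro n
    simp only [L, hy, hz, hw, hv]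
    have hk : k = ζ ^ 2 - ζ - 1 := by linarith
    rw [hk] at h3
    linear_combination (-w n) * h3
  have hLpow : ∀ n, L n = L 0 * ζ ^ n := by
    intro n
    induction n with
    | zero => simp
    | succ n ih =>
      rw [hL, ih]
      ring
  have hL0 : 0 < L 0 := by
    have h1 : 0 < ζ - 1 := by linarith
    have h0 : 0 < ζ := by linarith
    simp only [L]
    positivity
  refine ⟨(k - 1) * L 0 / (4 * k * (2 * ζ - 1)), ?_, ?_⟩
  · have h1 : 0 < k - 1 := by linarith
    have h2 : 0 < 2 * ζ - 1 := by linarith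
    positivity
  set a := (k - 1) * L 0 / (4 * k * (2 * ζ - 1)) with ha
  have haL : a * (4 * k * (2 * ζ - 1)) = (k - 1) * L 0 :=
    div_mul_cancel₀ _ (mul_ne_zero (by linarith) (by linarith))
  refine isBigO_two_pow_of_first_order (κ := 1 - ζ) (abs_lt.2 ⟨by linarith, by linarith⟩) ?_
  refine isBigO_two_pow_of_second_order (b := 1 - k) (abs_le.2 ⟨by linarith, by linarith⟩) ?_
  intro n
  have hyL : 2 * (y (n + 3) + (ζ - 2) * y (n + 2) + (k - ζ) * y (n + 1) +
      (ζ - 1) * (k - 1) * y n) = (k - 1) * L n := by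
    have e1 : y (n + 2) = z (n + 1) + y (n + 1) := hy (n + 1)
    have e2 : y (n + 3) = z (n + 2) + y (n + 2) := hy (n + 2)
    have e3 : z (n + 2) = w (n + 1) := hz (n + 1)
    simp only [L]
    rw [e2, e3, e1, hw, hz, hy]
    linear_combination (-2 * v n - ζ * w n) * h3 +
      (-2 * (k - 1) * v n - (k - 1) * ζ * w n) * hζsq
  rw [hLpow] at hyL
  linear_combination hyL / 2 - ζ ^ n / 2 * haL - a * ζ ^ n * (2 * ζ - 1) * hζsq

lemma exists_tendsto_div_zeta_pow {x p y y' z w v : ℕ → ℝ}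
    (hx : ∀ n, x (n + 1) = x n + p n + y' n) (hp : ∀ n, p n = v n + w n)
    (hy : ∀ n, y (n + 1) = z n + y n) (hy' : ∀ n, y' (n + 1) = z n + y' n)
    (hz : ∀ n, z (n + 1) = w n)
    (hw : ∀ n, w (n + 1) = v n + p n) (hv : ∀ n, v (n + 1) = w n + y n)
    (hy0 : 0 ≤ y 0) (hz0 : 0 ≤ z 0) (hw0 : 0 < w 0) (hv0 : 0 ≤ v 0) :
    ∃ b, 0 < b ∧ Filter.Tendsto (fun n => x n / zeta ^ n) Filter.atTop (nhds b) := by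
  obtain ⟨a, ha, hbig⟩ := exists_isBigO_sub_zeta_pow hy hz
    (fun n => by rw [hw, hp]; ring) hv hy0 hz0 hw0 hv0
  have hζ := two_lt_zeta
  have hdiff : ∀ n, y' n = y n + (y' 0 - y 0) := by
    intro n
    induction n with
    | zero => ring
    | succ n ih =>
      rw [hy', hy, ih]
      ring
  have hxy : ∀ n, x (n + 1) - x n = (y (n + 3) - y (n + 1)) / 2 + y n + (y' 0 - y 0) := by
    intro n
    have e2 : y (n + 2) = z (n + 1) + y (n + 1) := hy (n + 1)
    have e3 : y (n + 3) = z (n + 2) + y (n + 2) := hy (n + 2)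
    have f2 : z (n + 2) = w (n + 1) := hz (n + 1)
    rw [hx, hdiff, e3, e2, f2, hw, hz, hp]
    ring
  set b := a * ((zeta ^ 3 - zeta) / 2 + 1) / (zeta - 1)
  have hbmul : b * (zeta - 1) = a * ((zeta ^ 3 - zeta) / 2 + 1) :=
    div_mul_cancel₀ _ (by linarith)
  have hbpos : 0 < b := by
    have h1 : 0 < zeta - 1 := by linarith
    have h2 : 0 < zeta ^ 3 - zeta := by
      have : zeta ^ 3 - zeta = zeta * (zeta - 1) * (zeta + 1) := by ring
      rw [this]
      have : 0 < zeta := by linarith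
      positivity
    positivity
  refine ⟨b, hbpos, tendsto_div_zeta_pow ?_⟩
  refine isBigO_two_pow_of_first_order (κ := 1) (by norm_num) ?_
  have hconst : (fun _ : ℕ => y' 0 - y 0) =O[⊤] fun n : ℕ => (2 : ℝ) ^ n := by
    refine isBigO_top.2 ⟨|y' 0 - y 0|, fun n => ?_⟩
    simpa using le_mul_of_one_le_right (abs_nonneg (y' 0 - y 0))
      (one_le_pow₀ (by norm_num : (1 : ℝ) ≤ 2))
  have hsum := ((((isBigO_two_pow_shift hbig 3).sub (isBigO_two_pow_shift hbig 1)).const_mul_left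
    (1 / 2)).add hbig).add hconst
  refine hsum.congr_left fun n => ?_
  linear_combination zeta ^ n * hbmul - hxy n

/-- The number of prefixes of length `n`, summed over both values of the prepended letter. -/
noncomputable def prefixCountSum (C : Bool → Set (ℕ → Bool)) (n : ℕ) : ℝ :=
  prefixCount (C true) n + prefixCount (C false) n

lemma prefixCountSum_nonneg (C : Bool → Set (ℕ → Bool)) (n : ℕ) : 0 ≤ prefixCountSum C n := by
  unfold prefixCountSum
  positivity

lemma prefixCountSum_flipExt_pos (n : ℕ) : 0 < prefixCountSum flipExt n := by
  have hmem : tailSeq thueMorse ∈ flipExt false := by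
    refine ⟨?_, rfl⟩
    have h : consSeq (thueMorse 0) (tailSeq thueMorse) = thueMorse := consSeq_tailSeq _
    exact (show consSeq false (tailSeq thueMorse) = thueMorse from h).symm ▸ noOverlap_thueMorse
  have := prefixCount_pos ⟨_, hmem⟩ n
  unfold prefixCountSum
  positivity

/-- E(2^n) ∼ α ζ^n for some constant α > 0. -/
theorem E_two_pow_asymptotic :
    ∃ a : ℝ, 0 < a ∧
      Filter.Tendsto (fun n : ℕ => (E (2 ^ n) : ℝ) / zeta ^ n)
        Filter.atTop (nhds a) := by
  have hstep : ∀ n, 2 ^ (n + 1 + 3) = 2 * 2 ^ (n + 3) := fun n => by ring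
  have hlarge : ∀ n, 8 ≤ 2 ^ (n + 3) := fun n => by
    rw [pow_add]
    linarith [Nat.one_le_two_pow (n := n)]
  have hhalf : ∀ n, (2 ^ (n + 1 + 3) + 1) / 2 = 2 ^ (n + 3) := fun n => by
    have := hstep n
    omega
  have hhalf' : ∀ n, 2 ^ (n + 1 + 3) / 2 = 2 ^ (n + 3) := fun n => by
    have := hstep n
    omega
  have hpred : ∀ n, (2 ^ (n + 1 + 3) - 1) / 2 = 2 ^ (n + 3) - 1 := fun n => by
    have := hstep n
    omega
  have hpred' : ∀ n, (2 ^ (n + 1 + 3) - 1 + 1) / 2 = 2 ^ (n + 3) := fun n => by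
    have := hstep n
    have := hlarge n
    omega
  have hlarge' : ∀ n, 6 ≤ 2 ^ (n + 3) := fun n => by linarith [hlarge n]
  have hlarge'' : ∀ n, 6 ≤ 2 ^ (n + 3) - 1 := fun n => by
    have := hlarge n
    omega
  obtain ⟨b, hb, ht⟩ := exists_tendsto_div_zeta_pow
    (x := fun n => (prefixCount overlapFreeWords (2 ^ (n + 3)) : ℝ))
    (p := fun n => prefixCountSum leftExt (2 ^ (n + 3)))
    (y := fun n => prefixCountSum altExt (2 ^ (n + 3)))
    (y' := fun n => prefixCountSum altExt (2 ^ (n + 3) - 1))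
    (z := fun n => prefixCountSum flipTwoExt (2 ^ (n + 3)))
    (w := fun n => prefixCountSum flipExt (2 ^ (n + 3)))
    (v := fun n => prefixCountSum sameExt (2 ^ (n + 3)))
    (fun n => by
      simp only [prefixCountSum]
      rw [prefixCount_overlapFreeWords (hlarge' _), hhalf, hhalf', hpred]
      push_cast
      ring)
    (fun n => by
      simp only [prefixCountSum]
      rw [prefixCount_leftExt _ (Nat.one_le_two_pow), prefixCount_leftExt _ (Nat.one_le_two_pow)]
      push_cast
      ring)
    (fun n => by
      simp only [prefixCountSum]
      rw [prefixCount_altExt _ (hlarge' _), prefixCount_altExt _ (hlarge' _), hhalf, hhalf']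
      push_cast [Bool.not_true, Bool.not_false]
      ring)
    (fun n => by
      simp only [prefixCountSum]
      rw [prefixCount_altExt _ (hlarge'' _), prefixCount_altExt _ (hlarge'' _), hpred, hpred']
      push_cast [Bool.not_true, Bool.not_false]
      ring)
    (fun n => by
      simp only [prefixCountSum]
      rw [prefixCount_flipTwoExt _ (hlarge' _), prefixCount_flipTwoExt _ (hlarge' _), hhalf'])
    (fun n => by
      simp only [prefixCountSum]
      rw [prefixCount_flipExt _ (hlarge' _), prefixCount_flipExt _ (hlarge' _), hhalf, hhalf']
      push_cast [Bool.not_true, Bool.not_false]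
      ring)
    (fun n => by
      simp only [prefixCountSum]
      rw [prefixCount_sameExt _ (hlarge' _), prefixCount_sameExt _ (hlarge' _), hhalf, hhalf']
      push_cast [Bool.not_true, Bool.not_false]
      ring)
    (prefixCountSum_nonneg _ _) (prefixCountSum_nonneg _ _) (prefixCountSum_flipExt_pos _)
    (prefixCountSum_nonneg _ _)
  have hz3 : 0 < zeta ^ 3 := pow_pos (by linarith [two_lt_zeta]) 3
  refine ⟨b / zeta ^ 3, div_pos hb hz3, (Filter.tendsto_add_atTop_iff_nat 3).1 ?_⟩
  refine (ht.div_const (zeta ^ 3)).congr fun n => ?_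
  rw [E_eq_prefixCount, div_div, ← pow_add]
end
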